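/- Let G be a cubic triangle-free graph and M a set of edges of G, and let G' be the cubic graph obtained from G by attaching a co-fish to every edge of M (for each edge {u', v'} in M: subdivide {u', v'} by a new vertex, and identify that vertex with the leaf f of a new disjoint copy of the co-fish). Then G admits a {K_{1,3}, P_4}-decomposition in which no edge of M is the middle edge of a P_4 part if and only if G' admits a {K_{1,3}, K_3, P_4}-decomposition. -/

import Mathlib

open SimpleGraph

variable {V : Type*}

def IsTriangleOn (G : SimpleGraph V) (u v w : V) : Prop :=
  G.Adj u v ∧ G.Adj v w ∧ G.Adj u w

def triEdges [DecidableEq V] (u v w : V) : Finset (Sym2 V) :=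
  {s(u, v), s(v, w), s(u, w)}

def IsTrianglePart [DecidableEq V] (G : SimpleGraph V) (P : Finset (Sym2 V)) : Prop :=
  ∃ u v w : V, IsTriangleOn G u v w ∧ P = triEdges u v w

def clawEdges [DecidableEq V] (c a b d : V) : Finset (Sym2 V) :=
  {s(c, a), s(c, b), s(c, d)}

def IsClawPart [DecidableEq V] (G : SimpleGraph V) (P : Finset (Sym2 V)) : Prop :=
  ∃ c a b d : V, a ≠ b ∧ a ≠ d ∧ b ≠ d ∧
    G.Adj c a ∧ G.Adj c b ∧ G.Adj c d ∧ P = clawEdges c a b d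

def p4Edges [DecidableEq V] (a b c d : V) : Finset (Sym2 V) :=
  {s(a, b), s(b, c), s(c, d)}

def IsP4On (G : SimpleGraph V) (a b c d : V) : Prop :=
  G.Adj a b ∧ G.Adj b c ∧ G.Adj c d ∧ a ≠ c ∧ a ≠ d ∧ b ≠ d

def IsP4Part [DecidableEq V] (G : SimpleGraph V) (P : Finset (Sym2 V)) : Prop :=
  ∃ a b c d : V, IsP4On G a b c d ∧ P = p4Edges a b c d

/-- `D` is a partition of the edge set of `G` into parts each satisfying `allowed`. -/
def IsDecompOn [DecidableEq V] (G : SimpleGraph V)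
    (allowed : Finset (Sym2 V) → Prop) (D : Finset (Finset (Sym2 V))) : Prop :=
  (∀ P ∈ D, allowed P) ∧
  (D : Set (Finset (Sym2 V))).PairwiseDisjoint id ∧
  ∀ e : Sym2 V, e ∈ G.edgeSet ↔ ∃ P ∈ D, e ∈ P

/-- The edges of the co-fish graph on `Fin 6`, where `a b c d e f` are
`0 1 2 3 4 5`: edges `ab, ad, af, bc, be, cd, ce, de`; vertex `5` (= `f`) is its
leaf. -/
def cofishEdges : Set (Sym2 (Fin 6)) :=
  {s(0, 1), s(0, 3), s(0, 5), s(1, 2), s(1, 4), s(2, 3), s(2, 4), s(3, 4)}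

/-- The graph obtained from `G` by attaching a co-fish to every edge of `M`:
each edge `m = {u, v} ∈ M` is subdivided by a new vertex — the leaf `(m, 5)` of
a fresh copy of the co-fish on the six vertices `(m, 0), …, (m, 5)`. -/
def attachCofish (G : SimpleGraph V) (M : Set (Sym2 V)) :
    SimpleGraph (V ⊕ (↥M × Fin 6)) :=
  SimpleGraph.fromEdgeSet
    ({e | ∃ p q : V, G.Adj p q ∧ s(p, q) ∉ M ∧ e = s(Sum.inl p, Sum.inl q)} ∪
     {e | ∃ (m : ↥M) (p : V), p ∈ (m : Sym2 V) ∧ e = s(Sum.inl p, Sum.inr (m, 5))} ∪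
     {e | ∃ (m : ↥M) (i j : Fin 6), s(i, j) ∈ cofishEdges ∧
        e = s(Sum.inr (m, i), Sum.inr (m, j))})

section CofishGadget

variable {G : SimpleGraph V} {M : Set (Sym2 V)}

/-- The edge of `attachCofish G M` representing the edge `e` of `G`, where a subdivided edge `m` is
represented by its half at the endpoint `c m`. -/
noncomputable def liftEdge (c : ↥M → V) (e : Sym2 V) : Sym2 (V ⊕ (↥M × Fin 6)) :=
  open Classical in
  if h : e ∈ M then s(Sum.inl (c ⟨e, h⟩), Sum.inr (⟨e, h⟩, 5)) else e.map Sum.inl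

lemma liftEdge_of_mem (c : ↥M → V) (m : ↥M) :
    liftEdge c m = s(Sum.inl (c m), Sum.inr (m, 5)) := by
  simp [liftEdge]

lemma liftEdge_of_notMem (c : ↥M → V) {e : Sym2 V} (h : e ∉ M) :
    liftEdge c e = e.map Sum.inl := by
  simp [liftEdge, h]

lemma liftEdge_injective (c : ↥M → V) : Function.Injective (liftEdge c) := by
  intro e e' h
  by_cases he : e ∈ M <;> by_cases he' : e' ∈ M
  · lift e to ↥M using he
    lift e' to ↥M using he'
    rw [liftEdge_of_mem, liftEdge_of_mem] at h
    simp_all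
  · lift e to ↥M using he
    rw [liftEdge_of_mem, liftEdge_of_notMem c he'] at h
    induction e' with | _ p q => simp at h
  · lift e' to ↥M using he'
    rw [liftEdge_of_mem, liftEdge_of_notMem c he] at h
    induction e with | _ p q => simp at h
  · rw [liftEdge_of_notMem c he, liftEdge_of_notMem c he'] at h
    exact Sym2.map.injective Sum.inl_injective h

lemma exists_eq_mk_of_liftEdge_eq {c : ↥M → V} (hc : ∀ m : ↥M, c m ∈ (m : Sym2 V)) {e : Sym2 V}
    {p : V} {y : V ⊕ (↥M × Fin 6)} (h : liftEdge c e = s(Sum.inl p, y)) : ∃ q, e = s(p, q) := by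
  change p ∈ e
  by_cases he : e ∈ M
  · lift e to ↥M using he
    rw [liftEdge_of_mem] at h
    simp only [Sym2.eq_iff, Sum.inl.injEq, reduceCtorEq, and_false, or_false] at h
    exact h.1 ▸ hc e
  · rw [liftEdge_of_notMem c he] at h
    have : (Sum.inl p : V ⊕ (↥M × Fin 6)) ∈ e.map Sum.inl := by rw [h]; exact Sym2.mem_mk_left _ _
    simpa [Sym2.mem_map] using this

lemma eq_inl_of_liftEdge_eq {c : ↥M → V} {e : Sym2 V} {m : ↥M} {i : Fin 6}
    {y : V ⊕ (↥M × Fin 6)} (h : liftEdge c e = s(Sum.inr (m, i), y)) : y = Sum.inl (c m) := by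
  by_cases he : e ∈ M
  · lift e to ↥M using he
    rw [liftEdge_of_mem] at h
    simp only [Sym2.eq_iff, Sum.inr.injEq, Prod.mk.injEq, reduceCtorEq, false_and, false_or] at h
    rw [← h.1, h.2.1]
  · rw [liftEdge_of_notMem c he] at h
    induction e with | _ p q => simp at h

lemma liftEdge_mk_eq {c : ↥M → V} {p q : V} (h : ∀ hm : s(p, q) ∈ M, c ⟨_, hm⟩ = p) :
    ∃ y, liftEdge c s(p, q) = s(Sum.inl p, y) ∧
      (y = Sum.inl q ∨ ∃ m : ↥M, (m : Sym2 V) = s(p, q) ∧ y = Sum.inr (m, 5)) := by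
  by_cases hm : s(p, q) ∈ M
  · exact ⟨_, (liftEdge_of_mem c ⟨_, hm⟩).trans (by rw [h hm]), .inr ⟨⟨_, hm⟩, rfl, rfl⟩⟩
  · exact ⟨_, liftEdge_of_notMem c hm, .inl rfl⟩

variable [DecidableEq V]

/-- The eight edges of the copy of the co-fish attached to `m`. -/
def cofishAt (m : ↥M) : Finset (Sym2 (V ⊕ (↥M × Fin 6))) :=
  ({s(0, 1), s(0, 3), s(0, 5), s(1, 2), s(1, 4), s(2, 3), s(2, 4), s(3, 4)} :
    Finset (Sym2 (Fin 6))).image (Sym2.map fun i => Sum.inr (m, i))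

/-- The edges of the gadget at `m` which do not represent `m`: those of the co-fish, and the half
of `m` away from `v`. -/
def gadgetEdges (v : V) (m : ↥M) : Set (Sym2 (V ⊕ (↥M × Fin 6))) :=
  {e | e ∈ cofishAt m ∨ ∃ p ∈ (m : Sym2 V), p ≠ v ∧ e = s(Sum.inl p, Sum.inr (m, 5))}

lemma mem_cofishAt {m : ↥M} {e : Sym2 (V ⊕ (↥M × Fin 6))} :
    e ∈ cofishAt m ↔ ∃ i j, s(i, j) ∈ cofishEdges ∧ e = s(Sum.inr (m, i), Sum.inr (m, j)) := by
  constructor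
  · intro h
    obtain ⟨x, hx, rfl⟩ := Finset.mem_image.1 h
    induction x with | _ i j => exact ⟨i, j, by simpa [cofishEdges] using hx, rfl⟩
  · rintro ⟨i, j, h, rfl⟩
    exact Finset.mem_image.2 ⟨s(i, j), by simpa [cofishEdges] using h, rfl⟩

lemma card_cofishAt (m : ↥M) : (cofishAt m).card = 8 := by
  rw [cofishAt, Finset.card_image_of_injective]
  · decide
  · exact Sym2.map.injective fun i j h => by simpa using h

lemma mk_inr_notMem_cofishAt {m m' : ↥M} {i : Fin 6} {x : V ⊕ (↥M × Fin 6)} (h : m' ≠ m) :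
    s(x, Sum.inr (m', i)) ∉ cofishAt m := by
  rw [mem_cofishAt]
  rintro ⟨i, j, -, h'⟩
  rcases Sym2.eq_iff.1 h' with ⟨-, h'⟩ | ⟨-, h'⟩ <;> simp_all

lemma mk_inl_notMem_cofishAt {m : ↥M} {p : V} {x : V ⊕ (↥M × Fin 6)} :
    s(Sum.inl p, x) ∉ cofishAt m := by
  rw [mem_cofishAt]
  rintro ⟨i, j, -, h'⟩
  rcases Sym2.eq_iff.1 h' with ⟨h', -⟩ | ⟨h', -⟩ <;> simp_all

lemma mem_edgeSet_attachCofish {e : Sym2 (V ⊕ (↥M × Fin 6))} :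
    e ∈ (attachCofish G M).edgeSet ↔
      (∃ p q : V, G.Adj p q ∧ s(p, q) ∉ M ∧ e = s(Sum.inl p, Sum.inl q)) ∨
      (∃ (m : ↥M) (p : V), p ∈ (m : Sym2 V) ∧ e = s(Sum.inl p, Sum.inr (m, 5))) ∨
      ∃ m : ↥M, e ∈ cofishAt m := by
  simp only [attachCofish, edgeSet_fromEdgeSet, Set.mem_sdiff, Set.mem_union, Set.mem_ofPred_eq,
    mem_cofishAt, or_assoc, and_iff_left_iff_imp]
  rintro (⟨p, q, h, -, rfl⟩ | ⟨m, p, -, rfl⟩ | ⟨m, i, j, h, rfl⟩)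
  · simpa using h.ne
  · simp
  · have : i ≠ j := by
      rintro rfl
      revert i
      simp only [cofishEdges, Set.mem_insert_iff, Set.mem_singleton_iff]
      decide
    simpa using this

lemma liftEdge_notMem_gadgetEdges (c : ↥M → V) (m : ↥M) (e : Sym2 V) :
    liftEdge c e ∉ gadgetEdges (c m) m := by
  by_cases he : e ∈ M
  · lift e to ↥M using he
    rw [liftEdge_of_mem]
    rintro (h | ⟨p, -, hp, h⟩)
    · exact mk_inl_notMem_cofishAt h
    · simp only [Sym2.eq_iff, Sum.inl.injEq, Sum.inr.injEq, Prod.mk.injEq, reduceCtorEq] at h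
      obtain ⟨h1, h2, -⟩ | h := h
      · subst h2
        exact hp h1.symm
      · simp at h
  · rw [liftEdge_of_notMem c he]
    induction e with | _ p q =>
    rintro (h | ⟨p, -, hp, h⟩)
    · exact mk_inl_notMem_cofishAt h
    · simp at h

lemma eq_of_mem_gadgetEdges {v v' : V} {m m' : ↥M} {e : Sym2 (V ⊕ (↥M × Fin 6))}
    (h : e ∈ gadgetEdges v m) (h' : e ∈ gadgetEdges v' m') : m = m' := by
  rcases h with h | ⟨p, -, -, rfl⟩
  · rcases h' with h' | ⟨q, -, -, rfl⟩
    · obtain ⟨i, j, -, rfl⟩ := mem_cofishAt.1 h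
      by_contra hm
      exact mk_inr_notMem_cofishAt hm h'
    · exact (mk_inl_notMem_cofishAt h).elim
  · rcases h' with h' | ⟨q, -, -, h⟩
    · exact (mk_inl_notMem_cofishAt h').elim
    · simp at h
      exact h.2

lemma liftEdge_mem_edgeSet {c : ↥M → V} (hc : ∀ m : ↥M, c m ∈ (m : Sym2 V)) (hM : M ⊆ G.edgeSet)
    {e : Sym2 V} : liftEdge c e ∈ (attachCofish G M).edgeSet ↔ e ∈ G.edgeSet := by
  rw [mem_edgeSet_attachCofish]
  by_cases he : e ∈ M
  · refine iff_of_true (.inr (.inl ⟨⟨e, he⟩, _, hc ⟨e, he⟩, liftEdge_of_mem c ⟨e, he⟩⟩)) (hM he)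
  · rw [liftEdge_of_notMem c he]
    induction e with | _ p q =>
    constructor
    · rintro (⟨p', q', h, -, h'⟩ | ⟨m, p, -, h⟩ | ⟨m, h⟩)
      · rw [← Sym2.map_mk, (Sym2.map.injective Sum.inl_injective).eq_iff] at h'
        rwa [h']
      · simp at h
      · exact (mk_inl_notMem_cofishAt h).elim
    · intro h
      exact .inl ⟨p, q, h, he, rfl⟩

lemma exists_liftEdge_or_mem_gadgetEdges (c : ↥M → V) (hM : M ⊆ G.edgeSet)
    {e : Sym2 (V ⊕ (↥M × Fin 6))} (he : e ∈ (attachCofish G M).edgeSet) :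
    (∃ e₀ ∈ G.edgeSet, liftEdge c e₀ = e) ∨ ∃ m : ↥M, e ∈ gadgetEdges (c m) m := by
  rcases mem_edgeSet_attachCofish.1 he with ⟨p, q, h, hm, rfl⟩ | ⟨m, p, hp, rfl⟩ | ⟨m, h⟩
  · exact .inl ⟨s(p, q), h, liftEdge_of_notMem c hm⟩
  · by_cases hpc : p = c m
    · exact .inl ⟨m, hM m.2, by rw [liftEdge_of_mem, hpc]⟩
    · exact .inr ⟨m, .inr ⟨p, hp, hpc, rfl⟩⟩
  · exact .inr ⟨m, .inl h⟩

lemma mem_edgeSet_of_mem_gadgetEdges {v : V} {m : ↥M} {e : Sym2 (V ⊕ (↥M × Fin 6))}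
    (he : e ∈ gadgetEdges v m) : e ∈ (attachCofish G M).edgeSet := by
  rw [mem_edgeSet_attachCofish]
  rcases he with h | ⟨p, hp, -, rfl⟩
  · exact .inr (.inr ⟨m, h⟩)
  · exact .inr (.inl ⟨m, p, hp, rfl⟩)

lemma mem_edgeSet_inl_inl {p q : V} :
    s(Sum.inl p, Sum.inl q) ∈ (attachCofish G M).edgeSet ↔ G.Adj p q ∧ s(p, q) ∉ M := by
  rw [mem_edgeSet_attachCofish]
  constructor
  · rintro (⟨p', q', h, hm, h'⟩ | ⟨m, p, -, h⟩ | ⟨m, h⟩)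
    · rw [← Sym2.map_mk, ← Sym2.map_mk, (Sym2.map.injective Sum.inl_injective).eq_iff] at h'
      rw [← mem_edgeSet, h']
      exact ⟨h, hm⟩
    · simp at h
    · exact (mk_inl_notMem_cofishAt h).elim
  · rintro ⟨h, hm⟩
    exact .inl ⟨p, q, h, hm, rfl⟩

lemma isClawPart_image_liftEdge {c : ↥M → V} (hc : ∀ m : ↥M, c m ∈ (m : Sym2 V)) (hM : M ⊆ G.edgeSet)
    {Q : Finset (Sym2 V)} (hQ : IsClawPart G Q)
    (h : ∀ m : ↥M, (m : Sym2 V) ∈ Q → ∃ e ∈ Q, e ≠ m ∧ c m ∈ e) :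
    IsClawPart (attachCofish G M) (Q.image (liftEdge c)) := by
  obtain ⟨x, y₁, y₂, y₃, h12, h13, h23, h1, h2, h3, rfl⟩ := hQ
  have key : ∀ y, s(x, y) ∈ clawEdges x y₁ y₂ y₃ → ∃ z, liftEdge c s(x, y) = s(Sum.inl x, z) := by
    intro y hy
    obtain ⟨z, hz, -⟩ := liftEdge_mk_eq (c := c) (p := x) (q := y) (by
      intro hm
      obtain ⟨e, he, hne, hmem⟩ := h ⟨_, hm⟩ hy
      have hcm := hc ⟨_, hm⟩
      simp only [clawEdges, Finset.mem_insert, Finset.mem_singleton] at he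
      generalize c ⟨_, hm⟩ = w at *
      by_contra hw
      have hw' : w = y := by simpa [hw] using hcm
      subst hw'
      rcases he with rfl | rfl | rfl <;> simp [hw] at hmem <;> subst hmem <;> simp at hne)
    exact ⟨z, hz⟩
  obtain ⟨z₁, hz₁⟩ := key y₁ (by simp [clawEdges])
  obtain ⟨z₂, hz₂⟩ := key y₂ (by simp [clawEdges])
  obtain ⟨z₃, hz₃⟩ := key y₃ (by simp [clawEdges])
  have hne : ∀ {y y' z z'}, liftEdge c s(x, y) = s(Sum.inl x, z) →
      liftEdge c s(x, y') = s(Sum.inl x, z') → y ≠ y' → z ≠ z' := by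
    rintro y y' z _ h h' hy rfl
    exact hy (Sym2.congr_right.1 (liftEdge_injective c (h.trans h'.symm)))
  have hadj : ∀ {y z}, liftEdge c s(x, y) = s(Sum.inl x, z) → G.Adj x y →
      (attachCofish G M).Adj (Sum.inl x) z := by
    intro y z h hxy
    rw [← mem_edgeSet, ← h, liftEdge_mem_edgeSet hc hM]
    exact hxy
  refine ⟨Sum.inl x, z₁, z₂, z₃, hne hz₁ hz₂ h12, hne hz₁ hz₃ h13, hne hz₂ hz₃ h23, hadj hz₁ h1,
    hadj hz₂ h2, hadj hz₃ h3, ?_⟩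
  simp [clawEdges, Finset.image_insert, hz₁, hz₂, hz₃]

lemma isP4Part_image_liftEdge {c : ↥M → V} (hc : ∀ m : ↥M, c m ∈ (m : Sym2 V)) (hM : M ⊆ G.edgeSet)
    {x y z w : V} (hP : IsP4On G x y z w) (hyz : s(y, z) ∉ M)
    (h : ∀ m : ↥M, (m : Sym2 V) ∈ p4Edges x y z w → ∃ e ∈ p4Edges x y z w, e ≠ m ∧ c m ∈ e) :
    IsP4Part (attachCofish G M) ((p4Edges x y z w).image (liftEdge c)) := by
  obtain ⟨hxy, hyz', hzw, hxz, hxw, hyw⟩ := hP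
  obtain ⟨x', hx', hx''⟩ := liftEdge_mk_eq (c := c) (p := y) (q := x) (by
      intro hm
      obtain ⟨e, he, hne, hmem⟩ := h ⟨_, hm⟩ (by simp [p4Edges, Sym2.eq_swap])
      have hcm := hc ⟨_, hm⟩
      simp only [p4Edges, Finset.mem_insert, Finset.mem_singleton] at he
      generalize c ⟨_, hm⟩ = v at *
      by_contra hv
      have hv' : v = x := by simpa [hv] using hcm
      subst hv'
      rcases he with rfl | rfl | rfl <;> simp_all [Sym2.eq_swap])
  obtain ⟨w', hw', hw''⟩ := liftEdge_mk_eq (c := c) (p := z) (q := w) (by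
      intro hm
      obtain ⟨e, he, hne, hmem⟩ := h ⟨_, hm⟩ (by simp [p4Edges])
      have hcm := hc ⟨_, hm⟩
      simp only [p4Edges, Finset.mem_insert, Finset.mem_singleton] at he
      generalize c ⟨_, hm⟩ = v at *
      by_contra hv
      have hv' : v = w := by simpa [hv] using hcm
      subst hv'
      rcases he with rfl | rfl | rfl <;> simp_all [eq_comm])
  have hmid : liftEdge c s(y, z) = s(Sum.inl y, Sum.inl z) := liftEdge_of_notMem c hyz
  refine ⟨x', Sum.inl y, Sum.inl z, w', ⟨?_, ?_, ?_, ?_, ?_, ?_⟩, ?_⟩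
  · rw [adj_comm, ← mem_edgeSet, ← hx', liftEdge_mem_edgeSet hc hM]
    exact hxy.symm
  · rw [← mem_edgeSet, ← hmid, liftEdge_mem_edgeSet hc hM]
    exact hyz'
  · rw [← mem_edgeSet, ← hw', liftEdge_mem_edgeSet hc hM]
    exact hzw
  · rintro rfl
    have := liftEdge_injective c (hx'.trans hmid.symm)
    simp_all
  · rintro rfl
    rcases hx'' with rfl | ⟨m, hm, rfl⟩
    · rcases hw'' with hw'' | ⟨m, hm, hw''⟩
      · exact hxw (Sum.inl_injective hw'')
      · cases hw''
    · rcases hw'' with hw'' | ⟨m', hm', hw''⟩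
      · cases hw''
      · simp only [Sum.inr.injEq, Prod.mk.injEq, and_true] at hw''
        rw [← hw'', hm] at hm'
        simp at hm'
        aesop
  · rintro rfl
    have := liftEdge_injective c (hw'.trans (Sym2.eq_swap.trans hmid.symm))
    simp_all
  · rw [p4Edges, p4Edges, Sym2.eq_swap (a := x), Sym2.eq_swap (a := x')]
    simp [Finset.image_insert, hx', hw', hmid]

lemma isClawPart_of_image_liftEdge {c : ↥M → V} (hc : ∀ m : ↥M, c m ∈ (m : Sym2 V))
    (hM : M ⊆ G.edgeSet) {Q : Finset (Sym2 V)}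
    (hQ : IsClawPart (attachCofish G M) (Q.image (liftEdge c))) : IsClawPart G Q := by
  obtain ⟨x, y₁, y₂, y₃, h12, h13, h23, h1, h2, h3, hP⟩ := hQ
  have key : ∀ y, s(x, y) ∈ clawEdges x y₁ y₂ y₃ → ∃ e, liftEdge c e = s(x, y) := by
    intro y hy
    rw [← hP] at hy
    obtain ⟨e, -, h⟩ := Finset.mem_image.1 hy
    exact ⟨e, h⟩
  obtain ⟨e₁, he₁⟩ := key y₁ (by simp [clawEdges])
  obtain ⟨e₂, he₂⟩ := key y₂ (by simp [clawEdges])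
  obtain ⟨e₃, he₃⟩ := key y₃ (by simp [clawEdges])
  rcases x with p | ⟨m, i⟩
  swap
  · exact (h12 ((eq_inl_of_liftEdge_eq he₁).trans (eq_inl_of_liftEdge_eq he₂).symm)).elim
  obtain ⟨q₁, rfl⟩ := exists_eq_mk_of_liftEdge_eq hc he₁
  obtain ⟨q₂, rfl⟩ := exists_eq_mk_of_liftEdge_eq hc he₂
  obtain ⟨q₃, rfl⟩ := exists_eq_mk_of_liftEdge_eq hc he₃
  rw [← mem_edgeSet] at h1 h2 h3
  rw [← he₁, liftEdge_mem_edgeSet hc hM] at h1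
  rw [← he₂, liftEdge_mem_edgeSet hc hM] at h2
  rw [← he₃, liftEdge_mem_edgeSet hc hM] at h3
  refine ⟨p, q₁, q₂, q₃, ?_, ?_, ?_, h1, h2, h3, ?_⟩
  · rintro rfl
    exact h12 (Sym2.congr_right.1 (he₁.symm.trans he₂))
  · rintro rfl
    exact h13 (Sym2.congr_right.1 (he₁.symm.trans he₃))
  · rintro rfl
    exact h23 (Sym2.congr_right.1 (he₂.symm.trans he₃))
  · apply Finset.image_injective (liftEdge_injective c)
    rw [hP]
    simp [clawEdges, Finset.image_insert, he₁, he₂, he₃]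

lemma not_isTrianglePart_image_liftEdge (c : ↥M → V) (htf : G.CliqueFree 3)
    (Q : Finset (Sym2 V)) :
    ¬ IsTrianglePart (attachCofish G M) (Q.image (liftEdge c)) := by
  rintro ⟨x, y, z, ⟨hxy, hyz, hxz⟩, hP⟩
  have key : ∀ a b, s(a, b) ∈ triEdges x y z → ∃ e, liftEdge c e = s(a, b) := by
    intro a b hy
    rw [← hP] at hy
    obtain ⟨e, -, h⟩ := Finset.mem_image.1 hy
    exact ⟨e, h⟩
  obtain ⟨e₁, he₁⟩ := key x y (by simp [triEdges])
  obtain ⟨e₂, he₂⟩ := key y z (by simp [triEdges])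
  obtain ⟨e₃, he₃⟩ := key x z (by simp [triEdges])
  have he₁' := he₁.trans Sym2.eq_swap
  have he₂' := he₂.trans Sym2.eq_swap
  have he₃' := he₃.trans Sym2.eq_swap
  rcases x with x | ⟨m, i⟩
  swap
  · exact hyz.ne ((eq_inl_of_liftEdge_eq he₁).trans (eq_inl_of_liftEdge_eq he₃).symm)
  rcases y with y | ⟨m, i⟩
  swap
  · exact hxz.ne ((eq_inl_of_liftEdge_eq he₁').trans (eq_inl_of_liftEdge_eq he₂).symm)
  rcases z with z | ⟨m, i⟩
  swap
  · exact hxy.ne ((eq_inl_of_liftEdge_eq he₃').trans (eq_inl_of_liftEdge_eq he₂').symm)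
  rw [← mem_edgeSet] at hxy hyz hxz
  rw [mem_edgeSet_inl_inl] at hxy hyz hxz
  exact htf _ (is3Clique_triple_iff.2 ⟨hxy.1, hxz.1, hyz.1⟩)

lemma isP4Part_of_image_liftEdge {c : ↥M → V} (hc : ∀ m : ↥M, c m ∈ (m : Sym2 V))
    (hM : M ⊆ G.edgeSet) (htf : G.CliqueFree 3) {Q : Finset (Sym2 V)}
    (hQ : IsP4Part (attachCofish G M) (Q.image (liftEdge c))) :
    ∃ x y z w : V, IsP4On G x y z w ∧ Q = p4Edges x y z w ∧ s(y, z) ∉ M := by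
  obtain ⟨x, y, z, w, ⟨hxy, hyz, hzw, hxz, hxw, hyw⟩, hP⟩ := hQ
  have key : ∀ a b, s(a, b) ∈ p4Edges x y z w → ∃ e, liftEdge c e = s(a, b) := by
    intro a b hy
    rw [← hP] at hy
    obtain ⟨e, -, h⟩ := Finset.mem_image.1 hy
    exact ⟨e, h⟩
  obtain ⟨e₁, he₁⟩ := key y x (by simp [p4Edges, Sym2.eq_swap])
  obtain ⟨e₂, he₂⟩ := key y z (by simp [p4Edges])
  obtain ⟨e₃, he₃⟩ := key z w (by simp [p4Edges])
  rcases y with y | ⟨m, i⟩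
  swap
  · exact (hxz ((eq_inl_of_liftEdge_eq he₁).trans (eq_inl_of_liftEdge_eq he₂).symm)).elim
  rcases z with z | ⟨m, i⟩
  swap
  · exact (hyw ((eq_inl_of_liftEdge_eq (he₂.trans Sym2.eq_swap)).trans
      (eq_inl_of_liftEdge_eq he₃).symm)).elim
  obtain ⟨p, rfl⟩ := exists_eq_mk_of_liftEdge_eq hc he₁
  obtain ⟨q, rfl⟩ := exists_eq_mk_of_liftEdge_eq hc he₃
  rw [adj_comm] at hxy
  rw [← mem_edgeSet] at hxy hyz hzw
  rw [mem_edgeSet_inl_inl] at hyz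
  have hmid : liftEdge c s(y, z) = s(Sum.inl y, Sum.inl z) := liftEdge_of_notMem c hyz.2
  rw [← he₁, liftEdge_mem_edgeSet hc hM] at hxy
  rw [← he₃, liftEdge_mem_edgeSet hc hM] at hzw
  refine ⟨p, y, z, q, ⟨hxy.symm, hyz.1, hzw, ?_, ?_, ?_⟩, ?_, hyz.2⟩
  · rintro rfl
    exact hxz (Sym2.congr_right.1 (he₁.symm.trans hmid))
  · rintro rfl
    exact htf _ (is3Clique_triple_iff.2 ⟨hyz.1, hxy, hzw⟩)
  · rintro rfl
    exact hyw (Sym2.congr_right.1 ((Sym2.eq_swap.trans hmid.symm).trans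
      ((congrArg _ Sym2.eq_swap).trans he₃)))
  · apply Finset.image_injective (liftEdge_injective c)
    rw [hP, p4Edges, p4Edges, Sym2.eq_swap (a := p), Sym2.eq_swap (a := x)]
    simp [Finset.image_insert, he₁, hmid, he₃]

/-- The parts into which the edges of the gadget at `m` are decomposed when its half at the
endpoint `o` is used by the gadget. -/
def gadgetParts (o : V) (m : ↥M) : Finset (Finset (Sym2 (V ⊕ (↥M × Fin 6)))) :=
  {p4Edges (Sum.inl o) (Sum.inr (m, 5)) (Sum.inr (m, 0)) (Sum.inr (m, 1)),
    clawEdges (Sum.inr (m, 3)) (Sum.inr (m, 0)) (Sum.inr (m, 2)) (Sum.inr (m, 4)),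
    triEdges (Sum.inr (m, 1)) (Sum.inr (m, 2)) (Sum.inr (m, 4))}

lemma mem_gadgetEdges_iff_exists_gadgetParts {m : ↥M} {v o : V} (hm : (m : Sym2 V) = s(v, o))
    (hvo : v ≠ o) {e : Sym2 (V ⊕ (↥M × Fin 6))} :
    e ∈ gadgetEdges v m ↔ ∃ P ∈ gadgetParts o m, e ∈ P := by
  have ho : (∃ p ∈ (m : Sym2 V), p ≠ v ∧ e = s(Sum.inl p, Sum.inr (m, 5))) ↔
      e = s(Sum.inl o, Sum.inr (m, 5)) := by
    rw [hm]
    constructor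
    · rintro ⟨p, hp, hpv, rfl⟩
      rw [(Sym2.mem_iff.1 hp).resolve_left hpv]
    · rintro rfl
      exact ⟨o, Sym2.mem_mk_right _ _, hvo.symm, rfl⟩
  simp only [gadgetEdges, Set.mem_ofPred_eq, ho, cofishAt, Finset.image_insert,
    Finset.image_singleton, Sym2.map_mk, gadgetParts, p4Edges, clawEdges, triEdges,
    Finset.mem_insert, Finset.mem_singleton, exists_eq_or_imp, exists_eq_left]
  rw [Sym2.eq_swap (a := Sum.inr (m, 5)), Sym2.eq_swap (a := Sum.inr (m, 3)) (b := Sum.inr (m, 0)),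
    Sym2.eq_swap (a := Sum.inr (m, 3)) (b := Sum.inr (m, 2))]
  tauto

lemma gadgetParts_pairwiseDisjoint (o : V) (m : ↥M) :
    (gadgetParts o m : Set (Finset (Sym2 (V ⊕ (↥M × Fin 6))))).PairwiseDisjoint id := by
  simp [gadgetParts, p4Edges, clawEdges, triEdges, Set.pairwiseDisjoint_insert,
    Set.pairwiseDisjoint_singleton]

lemma allowed_of_mem_gadgetParts {m : ↥M} {v o : V} (hm : (m : Sym2 V) = s(v, o))
    (hvo : v ≠ o) {P : Finset (Sym2 (V ⊕ (↥M × Fin 6)))} (hP : P ∈ gadgetParts o m) :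
    IsClawPart (attachCofish G M) P ∨ IsTrianglePart (attachCofish G M) P ∨
      IsP4Part (attachCofish G M) P := by
  have hadj : ∀ x y, s(x, y) ∈ P → (attachCofish G M).Adj x y := fun x y h =>
    mem_edgeSet_of_mem_gadgetEdges ((mem_gadgetEdges_iff_exists_gadgetParts hm hvo).2 ⟨P, hP, h⟩)
  simp only [gadgetParts, Finset.mem_insert, Finset.mem_singleton] at hP
  rcases hP with rfl | rfl | rfl
  · refine .inr (.inr ⟨_, _, _, _, ⟨hadj _ _ ?_, hadj _ _ ?_, hadj _ _ ?_, ?_, ?_, ?_⟩, rfl⟩) <;>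
      simp [p4Edges]
  · refine .inl ⟨_, _, _, _, ?_, ?_, ?_, hadj _ _ ?_, hadj _ _ ?_, hadj _ _ ?_, rfl⟩ <;>
      simp [clawEdges]
  · refine .inr (.inl ⟨_, _, _, ⟨hadj _ _ ?_, hadj _ _ ?_, hadj _ _ ?_⟩, rfl⟩) <;>
      simp [triEdges]

lemma exists_eq_triple_of_part {W : Type*} [DecidableEq W] {H : SimpleGraph W}
    {P : Finset (Sym2 W)} (hP : IsClawPart H P ∨ IsTrianglePart H P ∨ IsP4Part H P) :
    ∃ e₁ e₂ e₃, e₁ ≠ e₂ ∧ e₁ ≠ e₃ ∧ e₂ ≠ e₃ ∧ P = {e₁, e₂, e₃} ∧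
      (∃ x, x ∈ e₁ ∧ x ∈ e₂) ∧ ∃ x, x ∈ e₂ ∧ x ∈ e₃ := by
  rcases hP with ⟨c, a, b, d, hab, had, hbd, -, -, -, rfl⟩ | ⟨u, v, w, ⟨huv, hvw, huw⟩, rfl⟩ |
    ⟨a, b, c, d, ⟨hab, hbc, hcd, hac, had, hbd⟩, rfl⟩
  · exact ⟨_, _, _, mt Sym2.congr_right.1 hab, mt Sym2.congr_right.1 had,
      mt Sym2.congr_right.1 hbd, rfl, ⟨c, by simp⟩, c, by simp⟩
  · refine ⟨_, _, _, ?_, ?_, ?_, rfl, ⟨v, by simp⟩, w, by simp⟩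
    · simp [huw.ne, huv.ne]
    · simp [hvw.ne, huw.ne]
    · simp [huv.ne', huw.ne', hvw.ne]
  · refine ⟨_, _, _, ?_, ?_, ?_, rfl, ⟨b, by simp⟩, c, by simp⟩
    · simp [hac, hab.ne]
    · simp [hac, had]
    · simp [hbd, hbc.ne]

lemma eq_of_mem_cofishAt_of_notMem {m : ↥M} {e e' : Sym2 (V ⊕ (↥M × Fin 6))}
    (he : e ∈ cofishAt m) (he' : e' ∉ cofishAt m) (hG : e' ∈ (attachCofish G M).edgeSet)
    (hx : ∃ x, x ∈ e ∧ x ∈ e') :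
    e = s(Sum.inr (m, 0), Sum.inr (m, 5)) ∧
      ∃ p ∈ (m : Sym2 V), e' = s(Sum.inl p, Sum.inr (m, 5)) := by
  obtain ⟨x, hxe, hxe'⟩ := hx
  obtain ⟨i, hxi⟩ : ∃ i, x = Sum.inr (m, i) := by
    obtain ⟨i, j, -, rfl⟩ := mem_cofishAt.1 he
    rcases Sym2.mem_iff.1 hxe with rfl | rfl
    exacts [⟨i, rfl⟩, ⟨j, rfl⟩]
  subst hxi
  rcases mem_edgeSet_attachCofish.1 hG with ⟨p, q, -, -, rfl⟩ | ⟨m', p, hp, rfl⟩ | ⟨m', h⟩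
  · simp at hxe'
  · simp only [Sym2.mem_iff, reduceCtorEq, Sum.inr.injEq, Prod.mk.injEq, false_or] at hxe'
    obtain ⟨rfl, rfl⟩ := hxe'
    refine ⟨?_, p, hp, rfl⟩
    simp only [cofishAt, Finset.image_insert, Finset.image_singleton, Sym2.map_mk,
      Finset.mem_insert, Finset.mem_singleton] at he
    rcases he with rfl | rfl | rfl | rfl | rfl | rfl | rfl | rfl <;> simp_all
  · obtain ⟨y, rfl⟩ := hxe'
    by_cases hm : m = m'
    · exact (he' (hm ▸ h)).elim
    · rw [Sym2.eq_swap] at h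
      exact (mk_inr_notMem_cofishAt hm h).elim

lemma exists_gadgetEdges_closed {D : Finset (Finset (Sym2 (V ⊕ (↥M × Fin 6))))}
    (hM : M ⊆ G.edgeSet)
    (hD : IsDecompOn (attachCofish G M) (fun P => IsClawPart (attachCofish G M) P ∨
      IsTrianglePart (attachCofish G M) P ∨ IsP4Part (attachCofish G M) P) D) (m : ↥M) :
    ∃ v ∈ (m : Sym2 V), ∀ P ∈ D, (∃ e ∈ P, e ∈ gadgetEdges v m) → ∀ e ∈ P, e ∈ gadgetEdges v m := by
  obtain ⟨hpart, hdisj, hcover⟩ := hD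
  have huniq : ∀ {P Q e}, P ∈ D → Q ∈ D → e ∈ P → e ∈ Q → P = Q := fun hP hQ he he' =>
    hdisj.elim_finset hP hQ _ he he'
  have hsub : ∀ e ∈ cofishAt m, e ∈ (attachCofish G M).edgeSet := fun e he =>
    mem_edgeSet_attachCofish.2 (.inr (.inr ⟨m, he⟩))
  have hEdge : ∀ P ∈ D, ∀ e ∈ P, e ∈ (attachCofish G M).edgeSet := fun P hP e he =>
    (hcover e).2 ⟨P, hP, he⟩
  set a : Sym2 (V ⊕ (↥M × Fin 6)) := s(Sum.inr (m, 0), Sum.inr (m, 5)) with ha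
  have haK : a ∈ cofishAt m := mem_cofishAt.2 ⟨0, 5, by simp [cofishEdges], rfl⟩
  obtain ⟨P₀, hP₀, haP₀⟩ := (hcover a).1 (hsub a haK)
  have hcross : ∀ {P e e'}, P ∈ D → e ∈ P → e' ∈ P → (∃ x, x ∈ e ∧ x ∈ e') → e ∈ cofishAt m →
      e' ∉ cofishAt m → P = P₀ ∧ ∃ p ∈ (m : Sym2 V), e' = s(Sum.inl p, Sum.inr (m, 5)) := by
    intro P e e' hP he he' hx hK hK'
    obtain ⟨h, h'⟩ := eq_of_mem_cofishAt_of_notMem hK hK' (hEdge P hP e' he') hx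
    rw [← ha] at h
    subst h
    exact ⟨huniq hP hP₀ he haP₀, h'⟩
  have hcross' : ∀ {P e e'}, P ∈ D → e ∈ P → e' ∈ P → (∃ x, x ∈ e ∧ x ∈ e') → e' ∈ cofishAt m →
      e ∉ cofishAt m → P = P₀ ∧ ∃ p ∈ (m : Sym2 V), e = s(Sum.inl p, Sum.inr (m, 5)) :=
    fun hP he he' ⟨x, hx, hx'⟩ => hcross hP he' he ⟨x, hx', hx⟩
  have hother : ∀ P ∈ D, P ≠ P₀ → (∃ e ∈ P, e ∈ cofishAt m) → P ⊆ cofishAt m := by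
    rintro P hP hne ⟨e, he, heK⟩
    obtain ⟨e₁, e₂, e₃, -, -, -, hPe, h12, h23⟩ := exists_eq_triple_of_part (hpart P hP)
    have m1 : e₁ ∈ P := by simp [hPe]
    have m2 : e₂ ∈ P := by simp [hPe]
    have m3 : e₃ ∈ P := by simp [hPe]
    have i12 : e₁ ∈ cofishAt m ↔ e₂ ∈ cofishAt m :=
      ⟨fun h => by_contra fun h' => hne (hcross hP m1 m2 h12 h h').1,
        fun h => by_contra fun h' => hne (hcross' hP m1 m2 h12 h h').1⟩
    have i23 : e₂ ∈ cofishAt m ↔ e₃ ∈ cofishAt m :=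
      ⟨fun h => by_contra fun h' => hne (hcross hP m2 m3 h23 h h').1,
        fun h => by_contra fun h' => hne (hcross' hP m2 m3 h23 h h').1⟩
    rw [hPe] at he ⊢
    intro e' he'
    simp only [Finset.mem_insert, Finset.mem_singleton] at he he'
    have k2 : e₂ ∈ cofishAt m := by
      rcases he with rfl | rfl | rfl
      exacts [i12.1 heK, heK, i23.2 heK]
    rcases he' with rfl | rfl | rfl
    exacts [i12.2 k2, k2, i23.1 k2]
  have hcard : (P₀ ∩ cofishAt m).card % 3 = 2 := by
    have h8 : ∑ P ∈ D, (P ∩ cofishAt m).card = 8 := by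
      rw [← card_cofishAt m, ← Finset.card_biUnion]
      · congr 1
        ext e
        simp only [Finset.mem_biUnion, Finset.mem_inter]
        constructor
        · rintro ⟨P, -, -, h⟩
          exact h
        · intro h
          obtain ⟨P, hP, he⟩ := (hcover e).1 (hsub e h)
          exact ⟨P, hP, he, h⟩
      · intro P hP Q hQ hPQ
        exact (hdisj hP hQ hPQ).mono Finset.inter_subset_left Finset.inter_subset_left
    rw [← Finset.add_sum_erase D _ hP₀] at h8
    have h3 : 3 ∣ ∑ P ∈ D.erase P₀, (P ∩ cofishAt m).card := by
      refine Finset.dvd_sum fun P hP => ?_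
      obtain ⟨hne, hP⟩ := Finset.mem_erase.1 hP
      by_cases h : ∃ e ∈ P, e ∈ cofishAt m
      · rw [Finset.inter_eq_left.2 (hother P hP hne h)]
        obtain ⟨e₁, e₂, e₃, h12, h13, h23, rfl, -, -⟩ := exists_eq_triple_of_part (hpart P hP)
        rw [Finset.card_eq_three.2 ⟨_, _, _, h12, h13, h23, rfl⟩]
      · push Not at h
        rw [Finset.disjoint_iff_inter_eq_empty.1 (Finset.disjoint_left.2 h)]
        simp
    omega
  obtain ⟨o, hom, hoP₀⟩ : ∃ o ∈ (m : Sym2 V), ∀ e ∈ P₀, e ∈ cofishAt m ∨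
      e = s(Sum.inl o, Sum.inr (m, 5)) := by
    obtain ⟨e₁, e₂, e₃, n12, n13, n23, hPe, h12, h23⟩ := exists_eq_triple_of_part (hpart P₀ hP₀)
    have m1 : e₁ ∈ P₀ := by simp [hPe]
    have m2 : e₂ ∈ P₀ := by simp [hPe]
    have m3 : e₃ ∈ P₀ := by simp [hPe]
    have c1 := hcross hP₀ m1 m2 h12
    have c2 := hcross' hP₀ m1 m2 h12
    have c3 := hcross hP₀ m2 m3 h23
    have c4 := hcross' hP₀ m2 m3 h23
    rw [hPe] at hcard
    simp only [hPe, Finset.mem_insert, Finset.mem_singleton, forall_eq_or_imp, forall_eq]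
    by_cases k1 : e₁ ∈ cofishAt m <;> by_cases k2 : e₂ ∈ cofishAt m <;>
      by_cases k3 : e₃ ∈ cofishAt m <;>
      simp [Finset.insert_inter_of_mem, Finset.insert_inter_of_notMem, k1, k2, k3, n12, n13,
        n23] at hcard
    · obtain ⟨-, o, ho, h⟩ := c3 k2 k3
      exact ⟨o, ho, .inl k1, .inl k2, .inr h⟩
    · obtain ⟨-, o, ho, h⟩ := c1 k1 k2
      exact ⟨o, ho, .inl k1, .inr h, .inl k3⟩
    · obtain ⟨-, o, ho, h⟩ := c2 k2 k1
      exact ⟨o, ho, .inr h, .inl k2, .inl k3⟩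
  refine ⟨Sym2.Mem.other hom, Sym2.other_mem hom, ?_⟩
  have hov : Sym2.Mem.other hom ≠ o := Sym2.other_ne (G.not_isDiag_of_mem_edgeSet (hM m.2)) hom
  have hin : ∀ e, e ∈ cofishAt m ∨ e = s(Sum.inl o, Sum.inr (m, 5)) →
      e ∈ gadgetEdges (Sym2.Mem.other hom) m :=
    fun e he => he.imp_right fun h => ⟨o, hom, hov.symm, h⟩
  have hoP : s(Sum.inl o, Sum.inr (m, 5)) ∈ P₀ := by
    by_contra hno
    have : P₀ ⊆ cofishAt m := fun e he => (hoP₀ e he).resolve_right fun h => hno (h ▸ he)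
    rw [Finset.inter_eq_left.2 this] at hcard
    obtain ⟨e₁, e₂, e₃, h12, h13, h23, h, -, -⟩ := exists_eq_triple_of_part (hpart P₀ hP₀)
    rw [Finset.card_eq_three.2 ⟨_, _, _, h12, h13, h23, h⟩] at hcard
    omega
  rintro P hP ⟨e, he, heg⟩ e' he'
  by_cases hPP : P = P₀
  · exact hin e' (hoP₀ e' (hPP ▸ he'))
  · rcases heg with heK | ⟨p, hp, hpv, rfl⟩
    · exact hin e' (.inl (hother P hP hPP ⟨e, he, heK⟩ he'))
    · have : p = o := by
        rw [← Sym2.other_spec hom, Sym2.mem_iff] at hp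
        exact hp.resolve_right hpv
      subst this
      exact (hPP (huniq hP hP₀ he hoP)).elim

lemma exists_decomp_attachCofish {D : Finset (Finset (Sym2 V))} (hM : M ⊆ G.edgeSet)
    (hD : IsDecompOn G (fun P => IsClawPart G P ∨
      (∃ a b c d : V, IsP4On G a b c d ∧ P = p4Edges a b c d ∧ s(b, c) ∉ M)) D) :
    ∃ D' : Finset (Finset (Sym2 (V ⊕ (↥M × Fin 6)))),
      IsDecompOn (attachCofish G M) (fun P => IsClawPart (attachCofish G M) P ∨
        IsTrianglePart (attachCofish G M) P ∨ IsP4Part (attachCofish G M) P) D' := by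
  obtain ⟨hpart, hdisj, hcover⟩ := hD
  have hinner : ∀ m : ↥M, ∃ v ∈ (m : Sym2 V), ∃ P ∈ D, (m : Sym2 V) ∈ P ∧
      ∃ e ∈ P, e ≠ m ∧ v ∈ e := by
    rintro ⟨m, hm⟩
    obtain ⟨P, hP, hmP⟩ := (hcover m).1 (hM hm)
    rcases hpart P hP with ⟨x, y₁, y₂, y₃, h12, h13, h23, -, -, -, rfl⟩ |
      ⟨x, y, z, w, ⟨-, -, -, hxz, -, hyw⟩, rfl, hyz⟩
    · refine ⟨x, ?_, _, hP, hmP, ?_⟩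
      · simp only [clawEdges, Finset.mem_insert, Finset.mem_singleton] at hmP
        rcases hmP with rfl | rfl | rfl <;> simp
      · by_cases h : m = s(x, y₁)
        · refine ⟨s(x, y₂), by simp [clawEdges], ?_, by simp⟩
          exact fun h' => h12.symm (Sym2.congr_right.1 (h'.trans h))
        · exact ⟨s(x, y₁), by simp [clawEdges], Ne.symm h, by simp⟩
    · have hmid : s(y, z) ≠ m := by
        rintro rfl
        exact hyz hm
      have hmid' : s(y, z) ∈ p4Edges x y z w := by simp [p4Edges]
      have hmP' := hmP
      simp only [p4Edges, Finset.mem_insert, Finset.mem_singleton] at hmP'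
      rcases hmP' with rfl | rfl | rfl
      · exact ⟨y, by simp, _, hP, hmP, _, hmid', hmid, by simp⟩
      · exact (hmid rfl).elim
      · exact ⟨z, by simp, _, hP, hmP, _, hmid', hmid, by simp⟩
  choose c hc hcD using hinner
  have hcP : ∀ P ∈ D, ∀ m : ↥M, (m : Sym2 V) ∈ P → ∃ e ∈ P, e ≠ m ∧ c m ∈ e := by
    intro P hP m hm
    obtain ⟨Q, hQ, hmQ, h⟩ := hcD m
    rwa [hdisj.elim_finset hP hQ _ hm hmQ]
  have ho : ∀ m : ↥M, ∃ o, (m : Sym2 V) = s(c m, o) ∧ c m ≠ o := fun m =>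
    ⟨_, (Sym2.other_spec (hc m)).symm,
      (Sym2.other_ne (G.not_isDiag_of_mem_edgeSet (hM m.2)) (hc m)).symm⟩
  choose o ho hco using ho
  have hgad : ∀ {m e}, e ∈ gadgetEdges (c m) m ↔ ∃ P ∈ gadgetParts (o m) m, e ∈ P :=
    fun {m e} => mem_gadgetEdges_iff_exists_gadgetParts (ho m) (hco m)
  have hlift : ∀ {P : Finset (Sym2 V)} {m Q}, Q ∈ gadgetParts (o m) m →
      Disjoint (P.image (liftEdge c)) Q := by
    intro P m Q hQ
    rw [Finset.disjoint_left]
    rintro e he heQ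
    obtain ⟨e, -, rfl⟩ := Finset.mem_image.1 he
    exact liftEdge_notMem_gadgetEdges c m e (hgad.2 ⟨Q, hQ, heQ⟩)
  have hfin : (Set.univ : Set ↥M).Finite := by
    have : M.Finite := (Finset.finite_toSet (D.biUnion id)).subset fun e he => by
      obtain ⟨P, hP, h⟩ := (hcover e).1 (hM he)
      exact Finset.mem_biUnion.2 ⟨P, hP, h⟩
    exact Set.finite_univ_iff.2 this
  have hmem : ∀ Q, Q ∈ D.image (Finset.image (liftEdge c)) ∪
      hfin.toFinset.biUnion (fun m => gadgetParts (o m) m) ↔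
      (∃ P ∈ D, P.image (liftEdge c) = Q) ∨ ∃ m, Q ∈ gadgetParts (o m) m := by
    simp
  refine ⟨D.image (Finset.image (liftEdge c)) ∪
    hfin.toFinset.biUnion (fun m => gadgetParts (o m) m), ?_, ?_, ?_⟩
  · intro Q hQ
    rcases (hmem Q).1 hQ with ⟨P, hP, rfl⟩ | ⟨m, hQ⟩
    · rcases hpart P hP with h | ⟨x, y, z, w, h, rfl, hyz⟩
      · exact .inl (isClawPart_image_liftEdge hc hM h (hcP P hP))
      · exact .inr (.inr (isP4Part_image_liftEdge hc hM h hyz (hcP _ hP)))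
    · exact allowed_of_mem_gadgetParts (ho m) (hco m) hQ
  · intro Q hQ Q' hQ' hne
    rcases (hmem Q).1 hQ with ⟨P, hP, rfl⟩ | ⟨m, hQ⟩ <;>
      rcases (hmem Q').1 hQ' with ⟨P', hP', rfl⟩ | ⟨m', hQ'⟩
    · exact (Finset.disjoint_image (liftEdge_injective c)).2
        (hdisj hP hP' fun h => hne (congrArg _ h))
    · exact hlift hQ'
    · exact (hlift hQ).symm
    · by_cases hm : m = m'
      · subst hm
        exact gadgetParts_pairwiseDisjoint _ _ hQ hQ' hne
      · exact Finset.disjoint_left.2 fun e he he' =>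
          hm (eq_of_mem_gadgetEdges (hgad.2 ⟨Q, hQ, he⟩) (hgad.2 ⟨Q', hQ', he'⟩))
  · intro e
    constructor
    · intro he
      rcases exists_liftEdge_or_mem_gadgetEdges c hM he with ⟨e, he₀, rfl⟩ | ⟨m, hm⟩
      · obtain ⟨P, hP, heP⟩ := (hcover e).1 he₀
        exact ⟨_, (hmem _).2 (.inl ⟨P, hP, rfl⟩), Finset.mem_image_of_mem _ heP⟩
      · obtain ⟨Q, hQ, heQ⟩ := hgad.1 hm
        exact ⟨Q, (hmem _).2 (.inr ⟨m, hQ⟩), heQ⟩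
    · rintro ⟨Q, hQ, he⟩
      rcases (hmem Q).1 hQ with ⟨P, hP, rfl⟩ | ⟨m, hQ⟩
      · obtain ⟨e, heP, rfl⟩ := Finset.mem_image.1 he
        exact (liftEdge_mem_edgeSet hc hM).2 ((hcover e).2 ⟨P, hP, heP⟩)
      · exact mem_edgeSet_of_mem_gadgetEdges (hgad.2 ⟨Q, hQ, he⟩)

lemma exists_decomp_of_attachCofish {D' : Finset (Finset (Sym2 (V ⊕ (↥M × Fin 6))))}
    (htf : G.CliqueFree 3) (hM : M ⊆ G.edgeSet)
    (hD : IsDecompOn (attachCofish G M) (fun P => IsClawPart (attachCofish G M) P ∨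
      IsTrianglePart (attachCofish G M) P ∨ IsP4Part (attachCofish G M) P) D') :
    ∃ D : Finset (Finset (Sym2 V)), IsDecompOn G (fun P => IsClawPart G P ∨
      (∃ a b c d : V, IsP4On G a b c d ∧ P = p4Edges a b c d ∧ s(b, c) ∉ M)) D := by
  choose c hc hclosed using exists_gadgetEdges_closed hM hD
  obtain ⟨hpart, hdisj, hcover⟩ := hD
  have hinj := liftEdge_injective c
  have hmem : ∀ Q, Q ∈ D'.preimage (Finset.image (liftEdge c))
      (Finset.image_injective hinj).injOn ↔ Q.image (liftEdge c) ∈ D' := by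
    simp
  refine ⟨D'.preimage (Finset.image (liftEdge c)) (Finset.image_injective hinj).injOn,
    ?_, ?_, ?_⟩
  · intro Q hQ
    rcases hpart _ ((hmem Q).1 hQ) with h | h | h
    · exact .inl (isClawPart_of_image_liftEdge hc hM h)
    · exact (not_isTrianglePart_image_liftEdge c htf Q h).elim
    · exact .inr (isP4Part_of_image_liftEdge hc hM htf h)
  · intro Q hQ Q' hQ' hne
    exact (Finset.disjoint_image hinj).1 (hdisj ((hmem Q).1 hQ) ((hmem Q').1 hQ')
      fun h => hne (Finset.image_injective hinj h))
  · intro e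
    rw [← liftEdge_mem_edgeSet hc hM, hcover]
    constructor
    · rintro ⟨P, hP, he⟩
      have hrange : ∀ e' ∈ P, ∃ e₀, liftEdge c e₀ = e' := by
        intro e' he'
        rcases exists_liftEdge_or_mem_gadgetEdges c hM ((hcover e').2 ⟨P, hP, he'⟩) with
          ⟨e₀, -, h⟩ | ⟨m, hm⟩
        · exact ⟨e₀, h⟩
        · exact (liftEdge_notMem_gadgetEdges c m e (hclosed m P hP ⟨e', he', hm⟩ _ he)).elim
      have himage : (P.preimage (liftEdge c) hinj.injOn).image (liftEdge c) = P := by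
        ext e'
        simp only [Finset.mem_image, Finset.mem_preimage]
        constructor
        · rintro ⟨e₀, h, rfl⟩
          exact h
        · intro he'
          obtain ⟨e₀, rfl⟩ := hrange e' he'
          exact ⟨e₀, he', rfl⟩
      refine ⟨P.preimage (liftEdge c) hinj.injOn, (hmem _).2 ?_, Finset.mem_preimage.2 he⟩
      rwa [himage]
    · rintro ⟨Q, hQ, he⟩
      exact ⟨_, (hmem Q).1 hQ, Finset.mem_image_of_mem _ he⟩

end CofishGadget

/-- A cubic triangle-free graph `G` with marked edge set `M` admits a
{K₁,₃, P₄}-decomposition in which no marked edge is the middle edge of a P₄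
iff the cubic graph obtained by attaching a co-fish to every marked edge admits
a {K₁,₃, K₃, P₄}-decomposition. -/
theorem stmt_16 [Fintype V] [DecidableEq V] (G : SimpleGraph V)
    (hcubic : ∀ v : V, (G.neighborSet v).ncard = 3)
    (htf : G.CliqueFree 3)
    (M : Set (Sym2 V)) (hM : M ⊆ G.edgeSet) :
    (∃ D : Finset (Finset (Sym2 V)),
        IsDecompOn G (fun P => IsClawPart G P ∨
          (∃ a b c d : V, IsP4On G a b c d ∧ P = p4Edges a b c d ∧ s(b, c) ∉ M)) D) ↔
      ∃ D' : Finset (Finset (Sym2 (V ⊕ (↥M × Fin 6)))),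
        IsDecompOn (attachCofish G M)
          (fun P => IsClawPart (attachCofish G M) P ∨
            IsTrianglePart (attachCofish G M) P ∨
            IsP4Part (attachCofish G M) P) D' := by
  exact ⟨fun ⟨_, hD⟩ => exists_decomp_attachCofish hM hD,
    fun ⟨_, hD⟩ => exists_decomp_of_attachCofish htf hM hD⟩
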